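/- arXiv:2401.03662 — 5 statements merged into one kernel-verified Lean document; each statement's English description precedes it below -/
import Mathlib

section
/- Let d : ℝ³ → ℝ³ be twice continuously differentiable, and let F(p)=(|p|²−1)² and f(p)=∇F(p)=4(|p|²−1)p. Then for every x ∈ ℝ³ and every j ∈ {1,2,3}, Σ_{i=1}^{3} ∂_i(∂_i d·∂_j d)(x) − ∂_j(½|∇d|²)(x) − ∂_j(F∘d)(x) = ∂_j d(x)·(Δd(x) − f(d(x))). Equivalently, div(∇d⊙∇d − ½|∇d|²I₃ − F(d)I₃) = (∇d)ᵀ(Δd − f(d)). -/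
/-- Partial derivative in direction `i` of a scalar function on `ℝ³`. -/
noncomputable def pd (i : Fin 3) (g : (Fin 3 → ℝ) → ℝ) (x : Fin 3 → ℝ) : ℝ :=
  fderiv ℝ g x (Pi.single i 1)

section PartialDerivative

variable {g h : (Fin 3 → ℝ) → ℝ} {x : Fin 3 → ℝ}

lemma pd_mul (i : Fin 3) (hg : DifferentiableAt ℝ g x) (hh : DifferentiableAt ℝ h x) :
    pd i (fun y => g y * h y) x = g x * pd i h x + h x * pd i g x := by
  simp [pd, fderiv_fun_mul hg hh]

lemma pd_const_mul (i : Fin 3) (c : ℝ) (hg : DifferentiableAt ℝ g x) :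
    pd i (fun y => c * g y) x = c * pd i g x := by
  simp [pd, fderiv_const_mul hg c]

lemma pd_sq (i : Fin 3) (hg : DifferentiableAt ℝ g x) :
    pd i (fun y => g y ^ 2) x = 2 * g x * pd i g x := by
  simp only [pow_two, pd_mul i hg hg]
  ring

lemma pd_sub_const (i : Fin 3) (c : ℝ) : pd i (fun y => g y - c) x = pd i g x := by
  simp [pd, fderiv_sub_const]

lemma pd_sum {ι : Type*} (s : Finset ι) (i : Fin 3) {u : ι → (Fin 3 → ℝ) → ℝ}
    (hu : ∀ k ∈ s, DifferentiableAt ℝ (u k) x) :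
    pd i (fun y => ∑ k ∈ s, u k y) x = ∑ k ∈ s, pd i (u k) x := by
  simp [pd, fderiv_fun_sum hu]

lemma ContDiff.differentiable_pd (hg : ContDiff ℝ 2 g) (i : Fin 3) :
    Differentiable ℝ (pd i g) :=
  ((hg.fderiv_right (m := 1) (by norm_num)).differentiable (by norm_num)).clm_apply
    (differentiable_const _)

lemma ContDiff.pd_comm (hg : ContDiff ℝ 2 g) (i j : Fin 3) (x : Fin 3 → ℝ) :
    pd i (pd j g) x = pd j (pd i g) x := by
  have hdiff : DifferentiableAt ℝ (fderiv ℝ g) x :=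
    (hg.fderiv_right (m := 1) (by norm_num)).differentiable (by norm_num) x
  have key (a b : Fin 3) :
      pd a (pd b g) x = fderiv ℝ (fderiv ℝ g) x (Pi.single a 1) (Pi.single b 1) := by
    change fderiv ℝ (fun y => fderiv ℝ g y (Pi.single b 1)) x (Pi.single a 1) = _
    simp [fderiv_clm_apply hdiff (differentiableAt_const _)]
  rw [key, key]
  exact (hg.contDiffAt.isSymmSndFDerivAt (by simp)).eq _ _

end PartialDerivative

/-- For `d : ℝ³ → ℝ³` twice continuously differentiable, with `F(p) = (|p|²-1)²` and
`f(p) = ∇F(p) = 4(|p|²-1)p`, one has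
`div(∇d ⊙ ∇d − ½|∇d|² I₃ − F(d) I₃) = (∇d)ᵀ (Δd − f(d))` componentwise. -/
theorem ericksen_stress_identity
    (d : (Fin 3 → ℝ) → (Fin 3 → ℝ)) (hd : ContDiff ℝ 2 d)
    (x : Fin 3 → ℝ) (j : Fin 3) :
    (∑ i : Fin 3,
        pd i (fun y => ∑ k : Fin 3, pd i (fun z => d z k) y * pd j (fun z => d z k) y) x)
      - pd j (fun y => (1 / 2) * ∑ i : Fin 3, ∑ k : Fin 3, (pd i (fun z => d z k) y) ^ 2) x
      - pd j (fun y => ((∑ k : Fin 3, (d y k) ^ 2) - 1) ^ 2) x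
    = ∑ k : Fin 3, pd j (fun z => d z k) x *
        ((∑ i : Fin 3, pd i (pd i (fun z => d z k)) x)
          - 4 * ((∑ m : Fin 3, (d x m) ^ 2) - 1) * d x k) := by
  have hk (k : Fin 3) : ContDiff ℝ 2 (fun z => d z k) := contDiff_pi.mp hd k
  have hu (k : Fin 3) : DifferentiableAt ℝ (fun z => d z k) x :=
    (hk k).differentiable (by norm_num) x
  have hp (i k : Fin 3) : DifferentiableAt ℝ (pd i (fun z => d z k)) x :=
    (hk k).differentiable_pd i x
  have h_elastic (i : Fin 3) :
      pd i (fun y => ∑ k : Fin 3, pd i (fun z => d z k) y * pd j (fun z => d z k) y) x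
        = ∑ k : Fin 3, (pd i (fun z => d z k) x * pd j (pd i (fun z => d z k)) x
          + pd j (fun z => d z k) x * pd i (pd i (fun z => d z k)) x) := by
    rw [pd_sum _ _ fun k _ => (hp i k).fun_mul (hp j k)]
    refine Finset.sum_congr rfl fun k _ => ?_
    rw [pd_mul i (hp i k) (hp j k), (hk k).pd_comm i j]
  have h_dirichlet :
      pd j (fun y => (1 / 2) * ∑ i : Fin 3, ∑ k : Fin 3, (pd i (fun z => d z k) y) ^ 2) x
        = ∑ i : Fin 3, ∑ k : Fin 3,
          pd i (fun z => d z k) x * pd j (pd i (fun z => d z k)) x := by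
    rw [pd_const_mul j _ (.fun_sum fun i _ => .fun_sum fun k _ => (hp i k).fun_pow 2),
      pd_sum _ _ fun i _ => .fun_sum fun k _ => (hp i k).fun_pow 2, Finset.mul_sum]
    refine Finset.sum_congr rfl fun i _ => ?_
    rw [pd_sum _ _ fun k _ => (hp i k).fun_pow 2, Finset.mul_sum]
    refine Finset.sum_congr rfl fun k _ => ?_
    rw [pd_sq j (hp i k)]
    ring
  have h_potential :
      pd j (fun y => ((∑ k : Fin 3, (d y k) ^ 2) - 1) ^ 2) x
        = ∑ k : Fin 3, pd j (fun z => d z k) x *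
          (4 * ((∑ m : Fin 3, (d x m) ^ 2) - 1) * d x k) := by
    rw [pd_sq j ((DifferentiableAt.fun_sum fun k _ => (hu k).fun_pow 2).sub_const 1), pd_sub_const,
      pd_sum _ _ fun k _ => (hu k).fun_pow 2, Finset.mul_sum]
    refine Finset.sum_congr rfl fun k _ => ?_
    rw [pd_sq j (hu k)]
    ring
  rw [Finset.sum_congr rfl fun i _ => h_elastic i, h_dirichlet, h_potential]
  simp only [Finset.sum_add_distrib, mul_sub (pd j _ x), Finset.sum_sub_distrib,
    add_sub_cancel_left]
  rw [Finset.sum_comm]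
  simp only [Finset.mul_sum]
end

section
/- Let τ₀ ∈ (0,1/2), C₀ > 0, r₀ > 0, and let Θ : (0,r₀] → [0,∞) be a function satisfying Θ(τ₀ s) ≤ ½ max{Θ(s), C₀ s³} for every s ∈ (0, r₀]. Then for every integer k ≥ 1, Θ(τ₀^k r₀) ≤ 2^{−k} max{Θ(r₀), C₀ r₀³/(1 − 2τ₀³)}. -/
/-- Iteration lemma: if `Θ : (0, r₀] → [0, ∞)` satisfies
`Θ(τ₀ s) ≤ ½ max {Θ(s), C₀ s³}` for all `s ∈ (0, r₀]`, where `τ₀ ∈ (0, 1/2)`, then for every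
`k ≥ 1` one has `Θ(τ₀^k r₀) ≤ 2^{−k} max {Θ(r₀), C₀ r₀³ / (1 − 2τ₀³)}`. -/
theorem decay_iteration (τ₀ C₀ r₀ : ℝ) (hτ : τ₀ ∈ Set.Ioo (0 : ℝ) (1 / 2))
    (hC₀ : 0 < C₀) (hr₀ : 0 < r₀)
    (Θ : ℝ → ℝ)
    (hΘnonneg : ∀ s : ℝ, 0 < s → s ≤ r₀ → 0 ≤ Θ s)
    (hΘiter : ∀ s : ℝ, 0 < s → s ≤ r₀ → Θ (τ₀ * s) ≤ (1 / 2) * max (Θ s) (C₀ * s ^ 3)) :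
    ∀ k : ℕ, 1 ≤ k →
      Θ (τ₀ ^ k * r₀) ≤ (1 / 2) ^ k * max (Θ r₀) (C₀ * r₀ ^ 3 / (1 - 2 * τ₀ ^ 3)) := by
  obtain ⟨hτ0, hτ1⟩ := hτ
  have hτ3 : τ₀ ^ 3 < 1 / 2 :=
    calc τ₀ ^ 3 ≤ τ₀ := pow_le_of_le_one hτ0.le (by linarith) three_ne_zero
      _ < 1 / 2 := hτ1
  set M := max (Θ r₀) (C₀ * r₀ ^ 3 / (1 - 2 * τ₀ ^ 3))
  have hM : C₀ * r₀ ^ 3 ≤ M := by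
    refine le_trans ?_ (le_max_right _ _)
    refine le_div_self (by positivity) (by linarith) ?_
    have : 0 < τ₀ ^ 3 := by positivity
    linarith
  intro k hk
  clear hk
  induction k with
  | zero => simp [M]
  | succ k ih =>
    have hs : τ₀ ^ k * r₀ ≤ r₀ :=
      mul_le_of_le_one_left hr₀.le (pow_le_one₀ hτ0.le (by linarith))
    have hcube : C₀ * (τ₀ ^ k * r₀) ^ 3 ≤ (1 / 2) ^ k * M :=
      calc C₀ * (τ₀ ^ k * r₀) ^ 3 = (τ₀ ^ 3) ^ k * (C₀ * r₀ ^ 3) := by ring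
        _ ≤ (1 / 2) ^ k * M := by gcongr
    calc Θ (τ₀ ^ (k + 1) * r₀) = Θ (τ₀ * (τ₀ ^ k * r₀)) := by congr 1; ring
      _ ≤ 1 / 2 * max (Θ (τ₀ ^ k * r₀)) (C₀ * (τ₀ ^ k * r₀) ^ 3) :=
        hΘiter _ (by positivity) hs
      _ ≤ 1 / 2 * ((1 / 2) ^ k * M) := by gcongr; exact max_le ih hcube
      _ = (1 / 2) ^ (k + 1) * M := by ring
end

section
/- There exists an absolute constant C>0 with the following property. Let g : ℝ³×ℝ → [0,∞) be Lebesgue integrable, let ε>0, and let Σ ⊆ ℝ³×ℝ be a set such that for every z ∈ Σ and every η>0 there exists r ∈ (0,η) with r^{−1}∫_{Q_r(z)} g ≥ ε. Then the one-dimensional Hausdorff measure of Σ with respect to the parabolic distance δ_p satisfies P¹(Σ) ≤ (C/ε)∫_{ℝ³×ℝ} g. -/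
open MeasureTheory

/-- `ℝ³ × ℝ` equipped with the parabolic distance
`δ_p((x,t),(y,s)) = max {‖x−y‖, √|t−s|}`. -/
def ParabolicSpace : Type := EuclideanSpace ℝ (Fin 3) × ℝ

noncomputable instance : MetricSpace ParabolicSpace where
  dist z w := max ‖z.1 - w.1‖ (Real.sqrt |z.2 - w.2|)
  dist_self z := by simp
  dist_comm z w := by
    show max ‖z.1 - w.1‖ (Real.sqrt |z.2 - w.2|) = max ‖w.1 - z.1‖ (Real.sqrt |w.2 - z.2|)
    rw [norm_sub_rev, abs_sub_comm]
  dist_triangle x y z := by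
    apply max_le
    · calc ‖x.1 - z.1‖ ≤ ‖x.1 - y.1‖ + ‖y.1 - z.1‖ := norm_sub_le_norm_sub_add_norm_sub _ _ _
        _ ≤ _ := add_le_add (le_max_left _ _) (le_max_left _ _)
    · have ha : (0:ℝ) ≤ |x.2 - y.2| := abs_nonneg _
      have hb : (0:ℝ) ≤ |y.2 - z.2| := abs_nonneg _
      have h2 : Real.sqrt |x.2 - z.2| ≤ Real.sqrt (|x.2 - y.2| + |y.2 - z.2|) :=
        Real.sqrt_le_sqrt (abs_sub_le _ _ _)
      have h3 : Real.sqrt (|x.2 - y.2| + |y.2 - z.2|)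
          ≤ Real.sqrt |x.2 - y.2| + Real.sqrt |y.2 - z.2| := by
        have h := Real.sqrt_le_sqrt
          (show |x.2 - y.2| + |y.2 - z.2|
              ≤ (Real.sqrt |x.2 - y.2| + Real.sqrt |y.2 - z.2|) ^ 2 by
            nlinarith [Real.sq_sqrt ha, Real.sq_sqrt hb,
              mul_nonneg (Real.sqrt_nonneg |x.2 - y.2|) (Real.sqrt_nonneg |y.2 - z.2|)])
        rwa [Real.sqrt_sq (by positivity)] at h
      exact le_trans (le_trans h2 h3)
        (add_le_add (le_max_right _ _) (le_max_right _ _))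
  eq_of_dist_eq_zero := by
    intro x y h
    have hA : ‖x.1 - y.1‖ = 0 := le_antisymm (h ▸ le_max_left _ _) (norm_nonneg _)
    have hB : Real.sqrt |x.2 - y.2| = 0 :=
      le_antisymm (h ▸ le_max_right _ _) (Real.sqrt_nonneg _)
    have h1 : x.1 = y.1 := sub_eq_zero.mp (norm_eq_zero.mp hA)
    have h2 : x.2 = y.2 := sub_eq_zero.mp
      (abs_eq_zero.mp ((Real.sqrt_eq_zero (abs_nonneg _)).mp hB))
    exact Prod.ext h1 h2

noncomputable instance : MeasurableSpace ParabolicSpace := borel ParabolicSpace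

instance : BorelSpace ParabolicSpace := ⟨rfl⟩

/-- The backward parabolic cylinder `B_r(x) × (t - r², t)` centred at `z = (x, t)`. -/
def parabolicCylinder (z : ParabolicSpace) (r : ℝ) : Set (EuclideanSpace ℝ (Fin 3) × ℝ) :=
  Metric.ball z.1 r ×ˢ Set.Ioo (z.2 - r ^ 2) z.2

theorem ParabolicSpace.dist_eq (z w : ParabolicSpace) :
    dist z w = max ‖z.1 - w.1‖ (Real.sqrt |z.2 - w.2|) := rfl

theorem isOpen_parabolicCylinder (z : ParabolicSpace) (r : ℝ) :
    IsOpen (parabolicCylinder z r) :=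
  Metric.isOpen_ball.prod isOpen_Ioo

theorem parabolicCylinder_nonempty (z : ParabolicSpace) {r : ℝ} (hr : 0 < r) :
    (parabolicCylinder z r).Nonempty :=
  (Metric.nonempty_ball.2 hr).prod (Set.nonempty_Ioo.2 (by linarith [pow_pos hr 2]))

theorem dist_lt_of_mem_parabolicCylinder {z w : ParabolicSpace} {r : ℝ} (hr : 0 < r)
    (hw : (w : EuclideanSpace ℝ (Fin 3) × ℝ) ∈ parabolicCylinder z r) : dist w z < r := by
  obtain ⟨hball, hlower, hupper⟩ := hw
  rw [ParabolicSpace.dist_eq]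
  refine max_lt (mem_ball_iff_norm.1 hball) ((Real.sqrt_lt' hr).2 ?_)
  rw [abs_lt]
  constructor <;> linarith

theorem dist_lt_of_parabolicCylinder_inter_nonempty {z w : ParabolicSpace} {r s : ℝ}
    (hr : 0 < r) (hs : 0 < s) (h : (parabolicCylinder z r ∩ parabolicCylinder w s).Nonempty) :
    dist z w < r + s := by
  obtain ⟨p, hpz, hpw⟩ := h
  exact (dist_triangle_left z w (p : ParabolicSpace)).trans_lt
    (add_lt_add (dist_lt_of_mem_parabolicCylinder hr hpz) (dist_lt_of_mem_parabolicCylinder hs hpw))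

/-- Vitali covering by parabolic cylinders: a bounded choice of radii on `S` admits a countable
disjoint subfamily of cylinders whose centres, with tripled radii, cover `S`. -/
theorem exists_countable_disjoint_parabolicCylinder_subfamily (S : Set ParabolicSpace)
    (r : ParabolicSpace → ℝ) (R : ℝ) (hr : ∀ z ∈ S, 0 < r z) (hR : ∀ z ∈ S, r z ≤ R) :
    ∃ u ⊆ S, u.Countable ∧ (u.PairwiseDisjoint fun z => parabolicCylinder z (r z)) ∧
      S ⊆ ⋃ z : u, Metric.closedBall (z : ParabolicSpace) (3 * r z) := by
  obtain ⟨u, huS, hdisj, hcover⟩ := Vitali.exists_disjoint_subfamily_covering_enlargement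
    (fun z => parabolicCylinder z (r z)) S r 2 one_lt_two (fun z hz => (hr z hz).le) R hR
    (fun z hz => parabolicCylinder_nonempty z (hr z hz))
  refine ⟨u, huS, hdisj.countable_of_isOpen (fun z _ => isOpen_parabolicCylinder z _)
    (fun z hz => parabolicCylinder_nonempty z (hr z (huS hz))), hdisj, fun z hz => ?_⟩
  obtain ⟨w, hw, hinter, hle⟩ := hcover z hz
  refine Set.mem_iUnion.2 ⟨⟨w, hw⟩, Metric.mem_closedBall.2 ?_⟩
  have := dist_lt_of_parabolicCylinder_inter_nonempty (hr z hz) (hr w (huS hw)) hinter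
  dsimp only
  linarith

theorem tsum_ofReal_setIntegral_le {α ι : Type*} [MeasurableSpace α] {μ : Measure α} [Countable ι]
    {g : α → ℝ} (hg : ∀ p, 0 ≤ g p) (hint : Integrable g μ) {B : ι → Set α}
    (hB : ∀ i, MeasurableSet (B i)) (hdisj : Pairwise (Function.onFun Disjoint B)) :
    ∑' i, ENNReal.ofReal (∫ p in B i, g p ∂μ) ≤ ENNReal.ofReal (∫ p, g p ∂μ) := by
  simp_rw [ofReal_integral_eq_lintegral_ofReal hint (Filter.Eventually.of_forall hg),
    fun i => ofReal_integral_eq_lintegral_ofReal (hint.restrict (s := B i))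
      (Filter.Eventually.of_forall hg)]
  rw [← lintegral_iUnion hB hdisj]
  exact setLIntegral_le_lintegral _ _

/-- Covering estimate: there is an absolute `C > 0` such that, whenever `g ≥ 0` is
Lebesgue-integrable on `ℝ³ × ℝ`, `ε > 0`, and every point `z` of `Σ` admits arbitrarily small
radii `r` with `r⁻¹ ∫_{Q_r(z)} g ≥ ε`, the one-dimensional parabolic Hausdorff measure of `Σ`
is at most `(C/ε) ∫ g`. -/
theorem parabolic_hausdorff_covering_bound :
    ∃ C > 0, ∀ g : EuclideanSpace ℝ (Fin 3) × ℝ → ℝ,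
      (∀ p, 0 ≤ g p) → Integrable g →
      ∀ ε : ℝ, 0 < ε →
      ∀ S : Set ParabolicSpace,
        (∀ z ∈ S, ∀ η : ℝ, 0 < η → ∃ r : ℝ, 0 < r ∧ r < η ∧
          ε ≤ r⁻¹ * ∫ p in (Metric.ball z.1 r) ×ˢ (Set.Ioo (z.2 - r ^ 2) z.2), g p) →
        μH[1] S ≤ ENNReal.ofReal ((C / ε) * ∫ p, g p) := by
  refine ⟨6, by norm_num, fun g hg hint ε hε S hS => ?_⟩
  have hfine (n : ℕ) (z : ParabolicSpace) : ∃ r : ℝ, z ∈ S → 0 < r ∧ r < 1 / ((n : ℝ) + 1) ∧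
      ε ≤ r⁻¹ * ∫ p in parabolicCylinder z r, g p := by
    by_cases hz : z ∈ S
    · obtain ⟨r, hr⟩ := hS z hz _ Nat.one_div_pos_of_nat
      exact ⟨r, fun _ => hr⟩
    · exact ⟨0, fun h => absurd h hz⟩
  choose r hr using hfine
  choose u huS hcount hdisj hcover using fun n : ℕ =>
    exists_countable_disjoint_parabolicCylinder_subfamily S (r n) (1 / ((n : ℝ) + 1))
      (fun z hz => (hr n z hz).1) (fun z hz => (hr n z hz).2.1.le)
  have (n : ℕ) : Countable (u n) := (hcount n).to_subtype
  have hdiam (n : ℕ) (z : u n) :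
      Metric.ediam (Metric.closedBall (z : ParabolicSpace) (3 * r n z)) ≤
        ENNReal.ofReal (6 * r n z) := by
    have h3 : 0 ≤ 3 * r n z := by linarith [(hr n z (huS n z.2)).1]
    rw [← Metric.closedEBall_ofReal h3]
    refine Metric.ediam_closedEBall_le.trans_eq ?_
    rw [← ENNReal.ofReal_ofNat 2, ← ENNReal.ofReal_mul zero_le_two]
    ring_nf
  refine (Measure.hausdorffMeasure_le_liminf_tsum 1 S
    (fun n : ℕ => ENNReal.ofReal (6 * (1 / ((n : ℝ) + 1)))) (l := Filter.atTop) ?_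
    (fun n (z : u n) => Metric.closedBall (z : ParabolicSpace) (3 * r n z))
    (Filter.Eventually.of_forall fun n z => (hdiam n z).trans (ENNReal.ofReal_le_ofReal ?_))
    (Filter.Eventually.of_forall hcover)).trans ?_
  · simpa using ENNReal.tendsto_ofReal (tendsto_one_div_add_atTop_nhds_zero_nat.const_mul (6 : ℝ))
  · linarith [(hr n z (huS n z.2)).2.1]
  refine Filter.liminf_le_of_frequently_le' (Filter.Frequently.of_forall fun n => ?_)
  simp_rw [ENNReal.rpow_one]
  calc
    _ ≤ ∑' z : u n, ENNReal.ofReal (6 / ε) *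
          ENNReal.ofReal (∫ p in parabolicCylinder z (r n z), g p) := by
      refine ENNReal.tsum_le_tsum fun z => (hdiam n z).trans ?_
      obtain ⟨hpos, -, hle⟩ := hr n z (huS n z.2)
      rw [← ENNReal.ofReal_mul (by positivity)]
      refine ENNReal.ofReal_le_ofReal ?_
      rw [le_inv_mul_iff₀ hpos] at hle
      rw [div_mul_eq_mul_div, le_div_iff₀ hε]
      linarith
    _ ≤ ENNReal.ofReal (6 / ε) * ENNReal.ofReal (∫ p, g p) := by
      rw [ENNReal.tsum_mul_left]
      gcongr
      exact tsum_ofReal_setIntegral_le hg hint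
        (fun z => (isOpen_parabolicCylinder _ _).measurableSet)
        ((hdisj n).subtype _ _)
    _ = _ := (ENNReal.ofReal_mul (by positivity)).symm
end

section
/- Let g : ℝ³×ℝ → [0,∞) be Lebesgue integrable, let ε>0, and let Σ ⊆ ℝ³×ℝ be a set such that for every z ∈ Σ and every η>0 there exists r ∈ (0,η) with r^{−1}∫_{Q_r(z)} g ≥ ε. Then the one-dimensional Hausdorff measure of Σ with respect to the parabolic distance δ_p is zero: P¹(Σ) = 0. -/
open MeasureTheory

namespace ParabolicSpace

open Set Filter Topology
open scoped ENNReal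

/-- The parabolic cylinder `Q_r(z) = B_r(x) × (t - r², t)`, where `z = (x, t)`. -/
def cylinder (z : ParabolicSpace) (r : ℝ) : Set (EuclideanSpace ℝ (Fin 3) × ℝ) :=
  Metric.ball z.1 r ×ˢ Ioo (z.2 - r ^ 2) z.2

lemma isOpen_cylinder (z : ParabolicSpace) (r : ℝ) : IsOpen (cylinder z r) :=
  Metric.isOpen_ball.prod isOpen_Ioo

lemma cylinder_nonempty (z : ParabolicSpace) {r : ℝ} (hr : 0 < r) : (cylinder z r).Nonempty :=
  (Metric.nonempty_ball.2 hr).prod (nonempty_Ioo.2 (by nlinarith [sq_pos_of_pos hr]))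

lemma dist_le_of_mem_cylinder {z : ParabolicSpace} {r : ℝ} (hr : 0 < r)
    {p : EuclideanSpace ℝ (Fin 3) × ℝ} (hp : p ∈ cylinder z r) :
    dist z (show ParabolicSpace from p) ≤ r := by
  obtain ⟨h1, h2, h3⟩ := hp
  refine max_le ?_ ?_
  · rw [← dist_eq_norm, dist_comm]
    exact (Metric.mem_ball.1 h1).le
  · refine Real.sqrt_le_iff.2 ⟨hr.le, ?_⟩
    change |z.2 - p.2| ≤ r ^ 2
    rw [abs_of_nonneg] <;> linarith

lemma volume_cylinder (z : ParabolicSpace) {r : ℝ} (hr : 0 < r) :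
    volume (cylinder z r) = ENNReal.ofReal r ^ 5 *
      volume (Metric.ball (0 : EuclideanSpace ℝ (Fin 3)) 1) := by
  rw [cylinder, Measure.volume_eq_prod, Measure.prod_prod, Real.volume_Ioo,
    Measure.addHaar_ball_of_pos _ _ hr, finrank_euclideanSpace_fin, sub_sub_cancel,
    ENNReal.ofReal_pow hr.le, ENNReal.ofReal_pow hr.le]
  ring

/-- Vitali's covering theorem for parabolic cylinders. -/
lemma exists_disjoint_cylinders_covering (S : Set ParabolicSpace) (ρ : ParabolicSpace → ℝ)
    {η : ℝ} (hρ : ∀ z ∈ S, 0 < ρ z) (hη : ∀ z ∈ S, ρ z ≤ η) :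
    ∃ u ⊆ S, u.Countable ∧ u.PairwiseDisjoint (fun z => cylinder z (ρ z)) ∧
      S ⊆ ⋃ z : u, Metric.closedBall (z : ParabolicSpace) (3 * ρ z) := by
  obtain ⟨u, huS, hdisj, hcov⟩ := Vitali.exists_disjoint_subfamily_covering_enlargement
    (fun z => cylinder z (ρ z)) S ρ 2 one_lt_two (fun z hz => (hρ z hz).le) η hη
    (fun z hz => cylinder_nonempty z (hρ z hz))
  refine ⟨u, huS, hdisj.countable_of_isOpen (fun z _ => isOpen_cylinder z _)
    (fun z hz => cylinder_nonempty z (hρ z (huS hz))), hdisj, fun a ha => ?_⟩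
  obtain ⟨b, hb, ⟨p, hpa, hpb⟩, hab⟩ := hcov a ha
  refine mem_iUnion.2 ⟨⟨b, hb⟩, Metric.mem_closedBall.2 ?_⟩
  have h1 := dist_le_of_mem_cylinder (hρ a ha) hpa
  have h2 := dist_le_of_mem_cylinder (hρ b (huS hb)) hpb
  rw [dist_comm] at h2
  calc dist a b ≤ _ := dist_triangle a p b
    _ ≤ ρ a + ρ b := add_le_add h1 h2
    _ ≤ 3 * ρ b := by linarith

/-- If every `z ∈ S` is the vertex of arbitrarily small cylinders of `f`-mass at least `c * r`, and
`f` has finite integral, then `S` has zero one-dimensional parabolic Hausdorff measure. -/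
lemma hausdorffMeasure_eq_zero_of_le_lintegral {f : EuclideanSpace ℝ (Fin 3) × ℝ → ℝ≥0∞}
    (hf : ∫⁻ p, f p ≠ ∞) {C : ℝ≥0∞} (hC : C ≠ ∞) (S : Set ParabolicSpace)
    (hS : ∀ z ∈ S, ∀ η : ℝ, 0 < η → ∃ r : ℝ, 0 < r ∧ r < η ∧
      ENNReal.ofReal r ≤ C * ∫⁻ p in cylinder z r, f p) :
    μH[1] S = 0 := by
  have hηpos (n : ℕ) : (0 : ℝ) < 1 / (n + 1) := by positivity
  choose! ρ hρ0 hρη hρ using fun (n : ℕ) z hz => hS z hz _ (hηpos n)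
  choose u huS hu hdisj hcov using fun n : ℕ =>
    exists_disjoint_cylinders_covering S (ρ n) (hρ0 n) (fun z hz => (hρη n z hz).le)
  have (n : ℕ) : Countable (u n) := (hu n).to_subtype
  let U (n : ℕ) := ⋃ z : u n, cylinder z (ρ n z)
  have hmeas (n : ℕ) (z : u n) : MeasurableSet (cylinder z (ρ n z)) :=
    (isOpen_cylinder _ _).measurableSet
  have hdis (n : ℕ) : Pairwise (Function.onFun Disjoint fun z : u n => cylinder z (ρ n z)) :=
    (hdisj n).subtype _ _
  have hsum (n : ℕ) : ∑' z : u n, ENNReal.ofReal (ρ n z) ≤ C * ∫⁻ p in U n, f p := by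
    rw [lintegral_iUnion (hmeas n) (hdis n), ← ENNReal.tsum_mul_left]
    exact ENNReal.tsum_le_tsum fun z => hρ n z (huS n z.2)
  set V := volume (Metric.ball (0 : EuclideanSpace ℝ (Fin 3)) 1)
  have hV : V ≠ ∞ := measure_ball_lt_top.ne
  have hη : Tendsto (fun n : ℕ => ENNReal.ofReal (1 / ((n : ℝ) + 1))) atTop (𝓝 0) := by
    simpa using ENNReal.tendsto_ofReal tendsto_one_div_add_atTop_nhds_zero_nat
  have hvol (n : ℕ) : volume (U n) ≤
      ENNReal.ofReal (1 / ((n : ℝ) + 1)) ^ 4 * (V * (C * ∫⁻ p, f p)) := by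
    calc volume (U n) ≤ ∑' z : u n, volume (cylinder z (ρ n z)) := measure_iUnion_le _
      _ ≤ ∑' z : u n, ENNReal.ofReal (1 / ((n : ℝ) + 1)) ^ 4 * V * ENNReal.ofReal (ρ n z) := by
        refine ENNReal.tsum_le_tsum fun z => ?_
        rw [volume_cylinder _ (hρ0 n z (huS n z.2)), pow_succ, mul_right_comm]
        gcongr
        exact (hρη n z (huS n z.2)).le
      _ ≤ _ := by
        rw [ENNReal.tsum_mul_left, mul_assoc]
        gcongr
        exact (hsum n).trans (mul_le_mul_right (setLIntegral_le_lintegral _ _) _)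
  have hvol0 : Tendsto (fun n => volume (U n)) atTop (𝓝 0) := by
    refine tendsto_of_tendsto_of_tendsto_of_le_of_le tendsto_const_nhds ?_
      (fun _ => zero_le) hvol
    have hfin : V * (C * ∫⁻ p, f p) ≠ ∞ := ENNReal.mul_ne_top hV (ENNReal.mul_ne_top hC hf)
    simpa using ENNReal.Tendsto.mul_const (ENNReal.Tendsto.pow (n := 4) hη) (Or.inr hfin)
  have hint : Tendsto (fun n => ∫⁻ p in U n, f p) atTop (𝓝 0) :=
    tendsto_setLIntegral_zero hf hvol0
  have hdiam (n : ℕ) (z : u n) : Metric.ediam (Metric.closedBall (z : ParabolicSpace) (3 * ρ n z)) ≤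
      6 * ENNReal.ofReal (ρ n z) := by
    have h0 := hρ0 n z (huS n z.2)
    rw [← Metric.closedEBall_ofReal (by positivity)]
    refine Metric.ediam_closedEBall_le.trans (le_of_eq ?_)
    rw [ENNReal.ofReal_mul (by norm_num), ENNReal.ofReal_ofNat, ← mul_assoc]
    norm_num
  have hlim : Tendsto (fun n => 6 * (C * ∫⁻ p in U n, f p)) atTop (𝓝 0) := by
    simpa using ENNReal.Tendsto.const_mul (a := 6)
      (ENNReal.Tendsto.const_mul hint (Or.inr hC)) (Or.inr (by simp))
  have hlimη : Tendsto (fun n : ℕ => 6 * ENNReal.ofReal (1 / ((n : ℝ) + 1))) atTop (𝓝 0) := by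
    simpa using ENNReal.Tendsto.const_mul hη (Or.inr (by simp))
  refine le_antisymm ?_ zero_le
  calc μH[1] S ≤ liminf (fun n => ∑' z : u n,
        Metric.ediam (Metric.closedBall (z : ParabolicSpace) (3 * ρ n z)) ^ (1 : ℝ)) atTop :=
        Measure.hausdorffMeasure_le_liminf_tsum 1 S _ hlimη _
          (Eventually.of_forall fun n z => (hdiam n z).trans
            (by gcongr; exact (hρη n z (huS n z.2)).le))
          (Eventually.of_forall hcov)
    _ ≤ liminf (fun n => 6 * (C * ∫⁻ p in U n, f p)) atTop := by
        refine liminf_le_liminf (Eventually.of_forall fun n => ?_)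
        simp only [ENNReal.rpow_one]
        refine (ENNReal.tsum_le_tsum (hdiam n)).trans ?_
        rw [ENNReal.tsum_mul_left]
        gcongr
        exact hsum n
    _ = 0 := hlim.liminf_eq

end ParabolicSpace

/-- Vanishing of the singular set: whenever `g ≥ 0` is Lebesgue-integrable on `ℝ³ × ℝ`,
`ε > 0`, and every point `z` of `Σ` admits arbitrarily small radii `r` with
`r⁻¹ ∫_{Q_r(z)} g ≥ ε`, the one-dimensional parabolic Hausdorff measure of `Σ` is zero. -/
theorem parabolic_hausdorff_measure_zero (g : EuclideanSpace ℝ (Fin 3) × ℝ → ℝ)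
    (hg0 : ∀ p, 0 ≤ g p) (hgint : Integrable g)
    (ε : ℝ) (hε : 0 < ε) (S : Set ParabolicSpace)
    (hS : ∀ z ∈ S, ∀ η : ℝ, 0 < η → ∃ r : ℝ, 0 < r ∧ r < η ∧
      ε ≤ r⁻¹ * ∫ p in (Metric.ball z.1 r) ×ˢ (Set.Ioo (z.2 - r ^ 2) z.2), g p) :
    μH[1] S = 0 := by
  have hlint : ∫⁻ p, ENNReal.ofReal (g p) ≠ ⊤ := by
    rw [← ofReal_integral_eq_lintegral_ofReal hgint (Filter.Eventually.of_forall hg0)]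
    exact ENNReal.ofReal_ne_top
  refine ParabolicSpace.hausdorffMeasure_eq_zero_of_le_lintegral hlint
    (C := ENNReal.ofReal ε⁻¹) ENNReal.ofReal_ne_top S fun z hz η hη => ?_
  obtain ⟨r, hr, hrη, h⟩ := hS z hz η hη
  refine ⟨r, hr, hrη, ?_⟩
  rw [← ofReal_integral_eq_lintegral_ofReal hgint.integrableOn (Filter.Eventually.of_forall hg0),
    ← ENNReal.ofReal_mul (by positivity)]
  refine ENNReal.ofReal_le_ofReal ?_
  rw [inv_mul_eq_div, le_div_iff₀ hr] at h
  rw [inv_mul_eq_div, le_div_iff₀ hε, mul_comm]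
  exact h
end

section
/- Let T>0, let F(p)=(|p|²−1)² and f(p)=∇F(p)=4(|p|²−1)p, and let u, d : ℝ³×[0,T] → ℝ³ and P : ℝ³×[0,T] → ℝ be smooth, ℤ³-periodic in the space variable, with div u = 0, solving the simplified Ericksen–Leslie system ∂_t u − Δu + u·∇u + ∇P = −div(∇d⊙∇d) and ∂_t d − Δd + u·∇d = −f(d) on ℝ³×(0,T]. Then for every t ∈ (0,T), (d/dt)∫_{[0,1]³}(½|u|² + ½|∇d|² + F(d)) dx = −∫_{[0,1]³}(|∇u|² + |Δd − f(d)|²) dx. -/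
open MeasureTheory

open Topology

/-- The derivative of `g` in the constant direction `v`. -/
noncomputable def dirDeriv {X : Type*} [NormedAddCommGroup X] [NormedSpace ℝ X]
    (v : X) (g : X → ℝ) (p : X) : ℝ :=
  fderiv ℝ g p v

section DirDeriv

variable {X : Type*} [NormedAddCommGroup X] [NormedSpace ℝ X]

theorem ContDiff.dirDeriv {g : X → ℝ} (hg : ContDiff ℝ (⊤ : ℕ∞) g) (v : X) :
    ContDiff ℝ (⊤ : ℕ∞) (dirDeriv v g) :=
  (hg.fderiv_right (m := (⊤ : ℕ∞)) (by simp)).clm_apply contDiff_const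

theorem ContDiff.differentiable_top {g : X → ℝ} (hg : ContDiff ℝ (⊤ : ℕ∞) g) :
    Differentiable ℝ g :=
  hg.differentiable (by simp)

theorem dirDeriv_comm {g : X → ℝ} (hg : ContDiff ℝ (⊤ : ℕ∞) g) (v w p : X) :
    dirDeriv v (dirDeriv w g) p = dirDeriv w (dirDeriv v g) p := by
  have hd : Differentiable ℝ (fderiv ℝ g) :=
    (hg.fderiv_right (m := (⊤ : ℕ∞)) (by simp)).differentiable (by simp)
  have key : ∀ a b : X, dirDeriv a (dirDeriv b g) p = fderiv ℝ (fderiv ℝ g) p a b := by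
    intro a b
    have h := (hd p).hasFDerivAt.clm_apply (hasFDerivAt_const b p)
    have h2 : fderiv ℝ (dirDeriv b g) p = _ := h.fderiv
    simp [dirDeriv, h2]
  rw [key, key]
  exact (hg.contDiffAt (x := p)).isSymmSndFDerivAt
    (by
      rw [minSmoothness_of_isRCLikeNormedField]
      exact WithTop.coe_le_coe.2 (le_top : (2 : ℕ∞) ≤ ⊤)) v w

theorem hasDerivAt_dirDeriv {g : X → ℝ} (hg : Differentiable ℝ g) (v p : X) :
    HasDerivAt (fun r : ℝ => g (p + r • v)) (dirDeriv v g p) 0 := by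
  have h1 : HasDerivAt (fun r : ℝ => p + r • v) v 0 := by
    simpa using ((hasDerivAt_id (0 : ℝ)).smul_const v).const_add p
  have h2 : HasFDerivAt g (fderiv ℝ g p) (p + (0 : ℝ) • v) := by
    simpa using (hg p).hasFDerivAt
  exact h2.comp_hasDerivAt (0 : ℝ) h1

theorem dirDeriv_eq_of_hasDerivAt {g : X → ℝ} (hg : Differentiable ℝ g) {v p : X} {c : ℝ}
    (h : HasDerivAt (fun r : ℝ => g (p + r • v)) c 0) : dirDeriv v g p = c :=
  (hasDerivAt_dirDeriv hg v p).unique h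

theorem dirDeriv_add_period {g : X → ℝ} {a : X} (hg : ∀ p, g (p + a) = g p) (v p : X) :
    dirDeriv v g (p + a) = dirDeriv v g p := by
  have : (fun q => g (q + a)) = g := funext hg
  rw [dirDeriv, dirDeriv, ← fderiv_comp_add_right, this]

end DirDeriv

/-- The `i`-th spatial unit vector of `ℝ³ × ℝ`. -/
noncomputable def spaceDir (i : Fin 3) : (Fin 3 → ℝ) × ℝ :=
  (Pi.single i 1, 0)

theorem pd_slice {g : (Fin 3 → ℝ) × ℝ → ℝ} (hg : Differentiable ℝ g) (i : Fin 3) (t : ℝ) :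
    pd i (fun y => g (y, t)) = fun x => dirDeriv (spaceDir i) g (x, t) := by
  funext x
  have h := (hg (x, t)).hasFDerivAt.comp x (hasFDerivAt_prodMk_left (𝕜 := ℝ) x t)
  have h2 : fderiv ℝ (fun y => g (y, t)) x = _ := h.fderiv
  simp [pd, h2, dirDeriv, spaceDir]

theorem hasDerivAt_time_slice {g : (Fin 3 → ℝ) × ℝ → ℝ} (hg : Differentiable ℝ g)
    (x : Fin 3 → ℝ) (t : ℝ) :
    HasDerivAt (fun s => g (x, s)) (dirDeriv (0, 1) g (x, t)) t := by
  have h := (hg (x, t)).hasFDerivAt.comp_hasDerivAt t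
    ((hasDerivAt_const t x).prodMk (hasDerivAt_id t))
  exact h

/-- The integral of a partial derivative of a periodic function over the unit cell vanishes. -/
theorem setIntegral_pd_eq_zero {g : (Fin 3 → ℝ) → ℝ} (hg : ContDiff ℝ 1 g) (i : Fin 3)
    (hper : ∀ x, g (x + Pi.single i 1) = g x) :
    ∫ x in Set.Icc (0 : Fin 3 → ℝ) 1, pd i g x = 0 := by
  classical
  have hc : Continuous (fun x => pd i g x) :=
    (hg.continuous_fderiv (by simp)).clm_apply continuous_const
  have hsum : ∀ x : Fin 3 → ℝ,
      ∑ j, (if j = i then fderiv ℝ g x else 0) (Pi.single j 1) = pd i g x := by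
    intro x
    rw [Finset.sum_eq_single i (by intro j _ h; simp [h]) (by simp)]
    simp [pd]
  have h := integral_divergence_of_hasFDerivAt_off_countable' (0 : Fin 3 → ℝ) 1
    (by intro j; simp) (fun j => if j = i then g else 0)
    (fun j x => if j = i then fderiv ℝ g x else 0) ∅ Set.countable_empty
    (by
      intro j
      split_ifs
      · exact hg.continuous.continuousOn
      · exact continuousOn_const)
    (by
      intro x _ j
      split_ifs
      · exact (hg.differentiable (by simp) x).hasFDerivAt
      · exact hasFDerivAt_const 0 x)
    (by
      simp only [hsum]
      exact hc.continuousOn.integrableOn_compact isCompact_Icc)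
  simp only [hsum] at h
  rw [h, Finset.sum_eq_zero]
  intro j _
  by_cases hj : j = i
  · subst hj
    have : ∀ x : Fin 2 → ℝ, g (j.insertNth (1 : ℝ) x) = g (j.insertNth (0 : ℝ) x) := by
      intro x
      rw [← hper (j.insertNth (0 : ℝ) x)]
      congr 1
      funext k
      refine Fin.succAboveCases j ?_ (fun k => ?_) k <;> simp
    simp [this]
  · simp [hj]

/-- Differentiation under the integral over the unit cell. -/
theorem hasDerivAt_setIntegral_cell {e : (Fin 3 → ℝ) × ℝ → ℝ}
    (he : ContDiff ℝ (⊤ : ℕ∞) e) (t : ℝ) :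
    HasDerivAt (fun s => ∫ x in Set.Icc (0 : Fin 3 → ℝ) 1, e (x, s))
      (∫ x in Set.Icc (0 : Fin 3 → ℝ) 1, dirDeriv (0, 1) e (x, t)) t := by
  have hc := (he.dirDeriv (0, 1)).continuous
  obtain ⟨C, hC⟩ := ((isCompact_Icc (a := (0 : Fin 3 → ℝ)) (b := 1)).prod
    (isCompact_closedBall t 1)).exists_bound_of_continuousOn hc.continuousOn
  have hslice : ∀ {f : (Fin 3 → ℝ) × ℝ → ℝ}, Continuous f → ∀ s,
      IntegrableOn (fun x => f (x, s)) (Set.Icc (0 : Fin 3 → ℝ) 1) := fun hf s =>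
    (hf.comp (Continuous.prodMk_left s)).continuousOn.integrableOn_compact isCompact_Icc
  refine (hasDerivAt_integral_of_dominated_loc_of_deriv_le (bound := fun _ => C)
    (F := fun s x => e (x, s)) (F' := fun s x => dirDeriv (0, 1) e (x, s))
    (Metric.closedBall_mem_nhds t one_pos) ?_ ?_ ?_ ?_ ?_ ?_).2
  · exact Filter.Eventually.of_forall fun s => (hslice he.continuous s).aestronglyMeasurable
  · exact hslice he.continuous t
  · exact (hslice hc t).aestronglyMeasurable
  · exact (ae_restrict_mem measurableSet_Icc).mono fun x hx s hs => hC (x, s) ⟨hx, hs⟩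
  · exact continuousOn_const.integrableOn_compact isCompact_Icc
  · exact Filter.Eventually.of_forall fun x s _ =>
      hasDerivAt_time_slice he.differentiable_top x s

/-- The energy density `½|u|² + ½|∇d|² + F(d)` as a function on space-time. -/
noncomputable def energyDensity (u d : Fin 3 → (Fin 3 → ℝ) × ℝ → ℝ) (p : (Fin 3 → ℝ) × ℝ) : ℝ :=
  (1 / 2) * (∑ k, (u k p) ^ 2)
    + (1 / 2) * (∑ i, ∑ k, (dirDeriv (spaceDir i) (d k) p) ^ 2)
    + ((∑ m, (d m p) ^ 2) - 1) ^ 2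

/-- The energy flux: the local energy balance reads
`∂ₜ e = -(|∇u|² + |Δd - f(d)|²) + ∑ᵢ ∂ᵢ (fluxᵢ)`. -/
noncomputable def energyFlux (u d : Fin 3 → (Fin 3 → ℝ) × ℝ → ℝ) (P : (Fin 3 → ℝ) × ℝ → ℝ)
    (i : Fin 3) (p : (Fin 3 → ℝ) × ℝ) : ℝ :=
  (∑ k, u k p * dirDeriv (spaceDir i) (u k) p)
    - u i p * (energyDensity u d p + P p)
    + ∑ k, dirDeriv (spaceDir i) (d k) p * dirDeriv (0, 1) (d k) p

section LocalBalance

variable {u d : Fin 3 → (Fin 3 → ℝ) × ℝ → ℝ} {P : (Fin 3 → ℝ) × ℝ → ℝ}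

theorem contDiff_energyDensity (hu : ∀ k, ContDiff ℝ (⊤ : ℕ∞) (u k))
    (hd : ∀ k, ContDiff ℝ (⊤ : ℕ∞) (d k)) : ContDiff ℝ (⊤ : ℕ∞) (energyDensity u d) := by
  have hD : ∀ i k, ContDiff ℝ (⊤ : ℕ∞) (dirDeriv (spaceDir i) (d k)) :=
    fun i k => (hd k).dirDeriv _
  unfold energyDensity
  fun_prop

theorem contDiff_energyFlux (hu : ∀ k, ContDiff ℝ (⊤ : ℕ∞) (u k))
    (hd : ∀ k, ContDiff ℝ (⊤ : ℕ∞) (d k)) (hP : ContDiff ℝ (⊤ : ℕ∞) P) (i : Fin 3) :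
    ContDiff ℝ (⊤ : ℕ∞) (energyFlux u d P i) := by
  have hD : ∀ v k, ContDiff ℝ (⊤ : ℕ∞) (dirDeriv v (d k)) := fun v k => (hd k).dirDeriv v
  have hU : ∀ v k, ContDiff ℝ (⊤ : ℕ∞) (dirDeriv v (u k)) := fun v k => (hu k).dirDeriv v
  have he := contDiff_energyDensity hu hd
  unfold energyFlux
  fun_prop

theorem dirDeriv_energyDensity (hu : ∀ k, ContDiff ℝ (⊤ : ℕ∞) (u k))
    (hd : ∀ k, ContDiff ℝ (⊤ : ℕ∞) (d k)) (v p : (Fin 3 → ℝ) × ℝ) :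
    dirDeriv v (energyDensity u d) p =
      (∑ k, u k p * dirDeriv v (u k) p)
        + (∑ i, ∑ k, dirDeriv (spaceDir i) (d k) p * dirDeriv v (dirDeriv (spaceDir i) (d k)) p)
        + 4 * ((∑ m, (d m p) ^ 2) - 1) * ∑ m, d m p * dirDeriv v (d m) p := by
  have h1 := fun k => hasDerivAt_dirDeriv (hu k).differentiable_top v p
  have h2 := fun k => hasDerivAt_dirDeriv (hd k).differentiable_top v p
  have h3 := fun i k => hasDerivAt_dirDeriv ((hd k).dirDeriv (spaceDir i)).differentiable_top v p
  refine dirDeriv_eq_of_hasDerivAt (contDiff_energyDensity hu hd).differentiable_top ?_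
  have h := (((HasDerivAt.fun_sum (u := Finset.univ) fun k _ => (h1 k).fun_pow 2).const_mul
      (1 / 2 : ℝ)).fun_add
    ((HasDerivAt.fun_sum (u := Finset.univ) fun i _ =>
      HasDerivAt.fun_sum (u := Finset.univ) fun k _ => (h3 i k).fun_pow 2).const_mul
      (1 / 2 : ℝ))).fun_add
    (((HasDerivAt.fun_sum (u := Finset.univ) fun m _ => (h2 m).fun_pow 2).sub_const 1).fun_pow 2)
  refine h.congr_deriv ?_
  simp only [zero_smul, add_zero, Fin.sum_univ_three]
  push_cast
  ring

theorem dirDeriv_energyFlux (hu : ∀ k, ContDiff ℝ (⊤ : ℕ∞) (u k))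
    (hd : ∀ k, ContDiff ℝ (⊤ : ℕ∞) (d k)) (hP : ContDiff ℝ (⊤ : ℕ∞) P) (i : Fin 3)
    (v p : (Fin 3 → ℝ) × ℝ) :
    dirDeriv v (energyFlux u d P i) p =
      (∑ k, (dirDeriv v (u k) p * dirDeriv (spaceDir i) (u k) p
          + u k p * dirDeriv v (dirDeriv (spaceDir i) (u k)) p))
        - (dirDeriv v (u i) p * (energyDensity u d p + P p)
          + u i p * (dirDeriv v (energyDensity u d) p + dirDeriv v P p))
        + ∑ k, (dirDeriv v (dirDeriv (spaceDir i) (d k)) p * dirDeriv (0, 1) (d k) p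
          + dirDeriv (spaceDir i) (d k) p * dirDeriv v (dirDeriv (0, 1) (d k)) p) := by
  have h1 := fun k => hasDerivAt_dirDeriv (hu k).differentiable_top v p
  have h2 := fun k => hasDerivAt_dirDeriv ((hu k).dirDeriv (spaceDir i)).differentiable_top v p
  have h3 := fun w k => hasDerivAt_dirDeriv ((hd k).dirDeriv w).differentiable_top v p
  have he := hasDerivAt_dirDeriv (contDiff_energyDensity hu hd).differentiable_top v p
  have h4 := hasDerivAt_dirDeriv hP.differentiable_top v p
  refine dirDeriv_eq_of_hasDerivAt (contDiff_energyFlux hu hd hP i).differentiable_top ?_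
  have h := ((HasDerivAt.fun_sum (u := Finset.univ) fun k _ => (h1 k).fun_mul (h2 k)).fun_sub
    ((h1 i).fun_mul (he.fun_add h4))).fun_add
    (HasDerivAt.fun_sum (u := Finset.univ) fun k _ => (h3 (spaceDir i) k).fun_mul (h3 (0, 1) k))
  refine h.congr_deriv ?_
  simp only [zero_smul, add_zero]

theorem dirDeriv_ericksenStress (hd : ∀ k, ContDiff ℝ (⊤ : ℕ∞) (d k)) (i k : Fin 3)
    (v p : (Fin 3 → ℝ) × ℝ) :
    dirDeriv v (fun q => ∑ m, dirDeriv (spaceDir i) (d m) q * dirDeriv (spaceDir k) (d m) q) p =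
      ∑ m, (dirDeriv v (dirDeriv (spaceDir i) (d m)) p * dirDeriv (spaceDir k) (d m) p
        + dirDeriv (spaceDir i) (d m) p * dirDeriv v (dirDeriv (spaceDir k) (d m)) p) := by
  have hD : ∀ v k, ContDiff ℝ (⊤ : ℕ∞) (dirDeriv v (d k)) := fun v k => (hd k).dirDeriv v
  have h3 := fun w k => hasDerivAt_dirDeriv (hD w k).differentiable_top v p
  refine dirDeriv_eq_of_hasDerivAt (ContDiff.differentiable_top (by fun_prop)) ?_
  have h := HasDerivAt.fun_sum (u := Finset.univ)
    fun m _ => (h3 (spaceDir i) m).fun_mul (h3 (spaceDir k) m)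
  refine h.congr_deriv ?_
  simp only [zero_smul, add_zero]

/-- Local energy balance for the simplified Ericksen–Leslie system. -/
theorem dirDeriv_time_energyDensity (hu : ∀ k, ContDiff ℝ (⊤ : ℕ∞) (u k))
    (hd : ∀ k, ContDiff ℝ (⊤ : ℕ∞) (d k)) (hP : ContDiff ℝ (⊤ : ℕ∞) P)
    (p : (Fin 3 → ℝ) × ℝ)
    (hdiv : ∑ i, dirDeriv (spaceDir i) (u i) p = 0)
    (hmom : ∀ k, dirDeriv (0, 1) (u k) p
        - (∑ i, dirDeriv (spaceDir i) (dirDeriv (spaceDir i) (u k)) p)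
        + (∑ i, u i p * dirDeriv (spaceDir i) (u k) p)
        + dirDeriv (spaceDir k) P p
      = -(∑ i, dirDeriv (spaceDir i) (fun q =>
            ∑ m, dirDeriv (spaceDir i) (d m) q * dirDeriv (spaceDir k) (d m) q) p))
    (hdir : ∀ k, dirDeriv (0, 1) (d k) p
        - (∑ i, dirDeriv (spaceDir i) (dirDeriv (spaceDir i) (d k)) p)
        + (∑ i, u i p * dirDeriv (spaceDir i) (d k) p)
      = -(4 * ((∑ m, (d m p) ^ 2) - 1) * d k p)) :
    dirDeriv (0, 1) (energyDensity u d) p =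
      (∑ i, dirDeriv (spaceDir i) (energyFlux u d P i) p)
        - ((∑ i, ∑ k, (dirDeriv (spaceDir i) (u k) p) ^ 2)
          + ∑ k, ((∑ i, dirDeriv (spaceDir i) (dirDeriv (spaceDir i) (d k)) p)
              - 4 * ((∑ m, (d m p) ^ 2) - 1) * d k p) ^ 2) := by
  simp only [dirDeriv_ericksenStress hd] at hmom
  have ht : ∀ i k, dirDeriv (0, 1) (dirDeriv (spaceDir i) (d k)) p
      = dirDeriv (spaceDir i) (dirDeriv (0, 1) (d k)) p := fun i k => dirDeriv_comm (hd k) _ _ _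
  simp only [dirDeriv_energyFlux hu hd hP]
  generalize energyDensity u d p = e
  simp only [dirDeriv_energyDensity hu hd, ht]
  have h10 := fun k => dirDeriv_comm (hd k) (spaceDir 1) (spaceDir 0) p
  have h20 := fun k => dirDeriv_comm (hd k) (spaceDir 2) (spaceDir 0) p
  have h21 := fun k => dirDeriv_comm (hd k) (spaceDir 2) (spaceDir 1) p
  have hm0 := hmom 0
  have hm1 := hmom 1
  have hm2 := hmom 2
  simp only [Fin.sum_univ_three, h10, h20, h21] at hdiv hm0 hm1 hm2 hdir ⊢
  linear_combination (e + P p) * hdiv + u 0 p * hm0 + u 1 p * hm1 + u 2 p * hm2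
    - (dirDeriv (spaceDir 0) (dirDeriv (spaceDir 0) (d 0)) p
      + dirDeriv (spaceDir 1) (dirDeriv (spaceDir 1) (d 0)) p
      + dirDeriv (spaceDir 2) (dirDeriv (spaceDir 2) (d 0)) p
      - 4 * (d 0 p ^ 2 + d 1 p ^ 2 + d 2 p ^ 2 - 1) * d 0 p) * hdir 0
    - (dirDeriv (spaceDir 0) (dirDeriv (spaceDir 0) (d 1)) p
      + dirDeriv (spaceDir 1) (dirDeriv (spaceDir 1) (d 1)) p
      + dirDeriv (spaceDir 2) (dirDeriv (spaceDir 2) (d 1)) p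
      - 4 * (d 0 p ^ 2 + d 1 p ^ 2 + d 2 p ^ 2 - 1) * d 1 p) * hdir 1
    - (dirDeriv (spaceDir 0) (dirDeriv (spaceDir 0) (d 2)) p
      + dirDeriv (spaceDir 1) (dirDeriv (spaceDir 1) (d 2)) p
      + dirDeriv (spaceDir 2) (dirDeriv (spaceDir 2) (d 2)) p
      - 4 * (d 0 p ^ 2 + d 1 p ^ 2 + d 2 p ^ 2 - 1) * d 2 p) * hdir 2

end LocalBalance

theorem setIntegral_dirDeriv_energyFlux_eq_zero {u d : Fin 3 → (Fin 3 → ℝ) × ℝ → ℝ}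
    {P : (Fin 3 → ℝ) × ℝ → ℝ} (hu : ∀ k, ContDiff ℝ (⊤ : ℕ∞) (u k))
    (hd : ∀ k, ContDiff ℝ (⊤ : ℕ∞) (d k)) (hP : ContDiff ℝ (⊤ : ℕ∞) P)
    (huper : ∀ k i p, u k (p + spaceDir i) = u k p)
    (hdper : ∀ k i p, d k (p + spaceDir i) = d k p)
    (hPper : ∀ i p, P (p + spaceDir i) = P p) (i : Fin 3) (t : ℝ) :
    ∫ x in Set.Icc (0 : Fin 3 → ℝ) 1, dirDeriv (spaceDir i) (energyFlux u d P i) (x, t) = 0 := by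
  have hV := contDiff_energyFlux hu hd hP i
  have h := setIntegral_pd_eq_zero (g := fun y => energyFlux u d P i (y, t))
    ((hV.of_le (by exact_mod_cast le_top)).comp (contDiff_prodMk_left t)) i (by
      intro x
      have hx : (x + Pi.single i 1, t) = (x, t) + spaceDir i := by simp [spaceDir]
      rw [hx]
      have hDu := fun v k => dirDeriv_add_period (huper k i) v (x, t)
      have hDd := fun v k => dirDeriv_add_period (hdper k i) v (x, t)
      simp only [energyFlux, energyDensity, hDu, hDd, huper, hdper, hPper])
  rwa [pd_slice hV.differentiable_top] at h

/-- The energy law for globally smooth periodic fields solving the system at time `t`. -/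
theorem hasDerivAt_setIntegral_energyDensity {u d : Fin 3 → (Fin 3 → ℝ) × ℝ → ℝ}
    {P : (Fin 3 → ℝ) × ℝ → ℝ} (t : ℝ) (hu : ∀ k, ContDiff ℝ (⊤ : ℕ∞) (u k))
    (hd : ∀ k, ContDiff ℝ (⊤ : ℕ∞) (d k)) (hP : ContDiff ℝ (⊤ : ℕ∞) P)
    (huper : ∀ k i p, u k (p + spaceDir i) = u k p)
    (hdper : ∀ k i p, d k (p + spaceDir i) = d k p)
    (hPper : ∀ i p, P (p + spaceDir i) = P p)
    (hdiv : ∀ x, ∑ i : Fin 3, pd i (fun y => u i (y, t)) x = 0)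
    (hmom : ∀ (x : Fin 3 → ℝ) (k : Fin 3),
      deriv (fun s => u k (x, s)) t
        - (∑ i : Fin 3, pd i (pd i (fun y => u k (y, t))) x)
        + (∑ i : Fin 3, u i (x, t) * pd i (fun y => u k (y, t)) x)
        + pd k (fun y => P (y, t)) x
      = -(∑ i : Fin 3, pd i (fun y =>
            ∑ m : Fin 3, pd i (fun y' => d m (y', t)) y * pd k (fun y' => d m (y', t)) y) x))
    (hdir : ∀ (x : Fin 3 → ℝ) (k : Fin 3),
      deriv (fun s => d k (x, s)) t
        - (∑ i : Fin 3, pd i (pd i (fun y => d k (y, t))) x)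
        + (∑ i : Fin 3, u i (x, t) * pd i (fun y => d k (y, t)) x)
      = -(4 * ((∑ m : Fin 3, (d m (x, t)) ^ 2) - 1) * d k (x, t))) :
    HasDerivAt (fun s => ∫ x in Set.Icc (0 : Fin 3 → ℝ) 1,
        ((1 / 2) * (∑ k : Fin 3, (u k (x, s)) ^ 2)
          + (1 / 2) * (∑ i : Fin 3, ∑ k : Fin 3, (pd i (fun y => d k (y, s)) x) ^ 2)
          + ((∑ m : Fin 3, (d m (x, s)) ^ 2) - 1) ^ 2))
      (-∫ x in Set.Icc (0 : Fin 3 → ℝ) 1,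
        ((∑ i : Fin 3, ∑ k : Fin 3, (pd i (fun y => u k (y, t)) x) ^ 2)
          + ∑ k : Fin 3,
              ((∑ i : Fin 3, pd i (pd i (fun y => d k (y, t))) x)
                - 4 * ((∑ m : Fin 3, (d m (x, t)) ^ 2) - 1) * d k (x, t)) ^ 2)) t := by
  have hDu : ∀ v k, ContDiff ℝ (⊤ : ℕ∞) (dirDeriv v (u k)) := fun v k => (hu k).dirDeriv v
  have hDd : ∀ v k, ContDiff ℝ (⊤ : ℕ∞) (dirDeriv v (d k)) := fun v k => (hd k).dirDeriv v
  have hDDd : ∀ v w k, ContDiff ℝ (⊤ : ℕ∞) (dirDeriv v (dirDeriv w (d k))) :=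
    fun v w k => (hDd w k).dirDeriv v
  have su := fun k i s => pd_slice (hu k).differentiable_top i s
  have sd := fun k i s => pd_slice (hd k).differentiable_top i s
  have sdu := fun k v i s => pd_slice (hDu v k).differentiable_top i s
  have sdd := fun k v i s => pd_slice (hDd v k).differentiable_top i s
  have sP := fun i s => pd_slice hP.differentiable_top i s
  have tu := fun k x => (hasDerivAt_time_slice (hu k).differentiable_top x t).deriv
  have td := fun k x => (hasDerivAt_time_slice (hd k).differentiable_top x t).deriv
  have sS := fun i k j s => pd_slice (g := fun q => ∑ m : Fin 3,
    dirDeriv (spaceDir i) (d m) q * dirDeriv (spaceDir k) (d m) q)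
    (ContDiff.differentiable_top (by fun_prop)) j s
  simp only [su, sd, sdu, sdd, sP, tu, td, sS] at hdiv hmom hdir ⊢
  refine (hasDerivAt_setIntegral_cell (contDiff_energyDensity hu hd) t).congr_deriv ?_
  have hint : ∀ {f : (Fin 3 → ℝ) × ℝ → ℝ}, ContDiff ℝ (⊤ : ℕ∞) f →
      IntegrableOn (fun x => f (x, t)) (Set.Icc (0 : Fin 3 → ℝ) 1) := fun hf =>
    (hf.continuous.comp (Continuous.prodMk_left t)).continuousOn.integrableOn_compact isCompact_Icc
  have hV := fun i => (contDiff_energyFlux hu hd hP i).dirDeriv (spaceDir i)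
  simp only [fun x => dirDeriv_time_energyDensity hu hd hP (x, t) (hdiv x) (hmom x) (hdir x)]
  rw [integral_sub (hint (f := fun q => ∑ i, dirDeriv (spaceDir i) (energyFlux u d P i) q)
      (by fun_prop))
    (hint (f := fun q => (∑ i, ∑ k, (dirDeriv (spaceDir i) (u k) q) ^ 2)
      + ∑ k, ((∑ i, dirDeriv (spaceDir i) (dirDeriv (spaceDir i) (d k)) q)
        - 4 * ((∑ m, (d m q) ^ 2) - 1) * d k q) ^ 2) (by fun_prop)),
    integral_finsetSum _ fun i _ => hint (hV i)]
  simp [setIntegral_dirDeriv_energyFlux_eq_zero hu hd hP huper hdper hPper]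

/-- Multiplying by a cutoff in time extends a function smooth on a time slab to all of
space-time. -/
theorem contDiff_timeCutoff_mul {g : (Fin 3 → ℝ) × ℝ → ℝ} {χ : ℝ → ℝ} {T : ℝ}
    (hg : ContDiffOn ℝ (⊤ : ℕ∞) g (Set.univ ×ˢ Set.Icc 0 T)) (hχ : ContDiff ℝ (⊤ : ℕ∞) χ)
    (hsupp : tsupport χ ⊆ Set.Ioo 0 T) :
    ContDiff ℝ (⊤ : ℕ∞) (fun p : (Fin 3 → ℝ) × ℝ => χ p.2 * g p) := by
  rw [contDiff_iff_contDiffAt]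
  intro p
  by_cases hp : p.2 ∈ tsupport χ
  · have hmem : Set.univ ×ˢ Set.Icc 0 T ∈ 𝓝 p := by
      rw [← Prod.mk.eta (p := p)]
      exact prod_mem_nhds Filter.univ_mem (Icc_mem_nhds (hsupp hp).1 (hsupp hp).2)
    exact (hχ.comp contDiff_snd).contDiffAt.mul (hg.contDiffAt hmem)
  · refine (contDiffAt_const (c := (0 : ℝ))).congr_of_eventuallyEq ?_
    have h := continuous_snd.continuousAt.eventually (notMem_tsupport_iff_eventuallyEq.1 hp)
    filter_upwards [h] with q hq
    simp [hq]

/-- Global energy law for smooth periodic solutions of the simplified Ericksen–Leslie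
system with `F(p) = (|p|²−1)²`, `f(p) = ∇F(p) = 4(|p|²−1)p`:
`(d/dt) ∫_{[0,1]³} (½|u|² + ½|∇d|² + F(d)) = −∫_{[0,1]³} (|∇u|² + |Δd − f(d)|²)`. -/
theorem ericksen_leslie_energy_law (T : ℝ) (hT : 0 < T)
    (u d : (Fin 3 → ℝ) × ℝ → (Fin 3 → ℝ)) (P : (Fin 3 → ℝ) × ℝ → ℝ)
    (hu : ContDiffOn ℝ (⊤ : ℕ∞) u (Set.univ ×ˢ Set.Icc 0 T))
    (hd : ContDiffOn ℝ (⊤ : ℕ∞) d (Set.univ ×ˢ Set.Icc 0 T))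
    (hP : ContDiffOn ℝ (⊤ : ℕ∞) P (Set.univ ×ˢ Set.Icc 0 T))
    (huper : ∀ (x : Fin 3 → ℝ) (t : ℝ) (n : Fin 3 → ℤ),
      u (x + fun i => (n i : ℝ), t) = u (x, t))
    (hdper : ∀ (x : Fin 3 → ℝ) (t : ℝ) (n : Fin 3 → ℤ),
      d (x + fun i => (n i : ℝ), t) = d (x, t))
    (hPper : ∀ (x : Fin 3 → ℝ) (t : ℝ) (n : Fin 3 → ℤ),
      P (x + fun i => (n i : ℝ), t) = P (x, t))
    (hdiv : ∀ (x : Fin 3 → ℝ), ∀ t ∈ Set.Icc (0 : ℝ) T,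
      ∑ i : Fin 3, pd i (fun y => u (y, t) i) x = 0)
    (hmom : ∀ (x : Fin 3 → ℝ), ∀ t ∈ Set.Ioc (0 : ℝ) T, ∀ k : Fin 3,
      deriv (fun s => u (x, s) k) t
        - (∑ i : Fin 3, pd i (pd i (fun y => u (y, t) k)) x)
        + (∑ i : Fin 3, u (x, t) i * pd i (fun y => u (y, t) k) x)
        + pd k (fun y => P (y, t)) x
      = -(∑ i : Fin 3, pd i (fun y =>
            ∑ m : Fin 3, pd i (fun y' => d (y', t) m) y
              * pd k (fun y' => d (y', t) m) y) x))
    (hdir : ∀ (x : Fin 3 → ℝ), ∀ t ∈ Set.Ioc (0 : ℝ) T, ∀ k : Fin 3,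
      deriv (fun s => d (x, s) k) t
        - (∑ i : Fin 3, pd i (pd i (fun y => d (y, t) k)) x)
        + (∑ i : Fin 3, u (x, t) i * pd i (fun y => d (y, t) k) x)
      = -(4 * ((∑ m : Fin 3, (d (x, t) m) ^ 2) - 1) * d (x, t) k)) :
    ∀ t ∈ Set.Ioo (0 : ℝ) T,
      HasDerivAt (fun s => ∫ x in Set.Icc (0 : Fin 3 → ℝ) 1,
          ((1 / 2) * (∑ k : Fin 3, (u (x, s) k) ^ 2)
            + (1 / 2) * (∑ i : Fin 3, ∑ k : Fin 3, (pd i (fun y => d (y, s) k) x) ^ 2)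
            + ((∑ m : Fin 3, (d (x, s) m) ^ 2) - 1) ^ 2))
        (-∫ x in Set.Icc (0 : Fin 3 → ℝ) 1,
          ((∑ i : Fin 3, ∑ k : Fin 3, (pd i (fun y => u (y, t) k) x) ^ 2)
            + ∑ k : Fin 3,
                ((∑ i : Fin 3, pd i (pd i (fun y => d (y, t) k)) x)
                  - 4 * ((∑ m : Fin 3, (d (x, t) m) ^ 2) - 1) * d (x, t) k) ^ 2))
        t := by
  intro t ht
  obtain ⟨r, hr, hball⟩ := Metric.nhds_basis_closedBall.mem_iff.1 (Ioo_mem_nhds ht.1 ht.2)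
  let χ : ContDiffBump t := ⟨r / 2, r, half_pos hr, half_lt_self hr⟩
  have hsupp : tsupport χ ⊆ Set.Ioo 0 T := χ.tsupport_eq ▸ hball
  have hχ : ContDiff ℝ (⊤ : ℕ∞) χ := χ.contDiff
  have hone : ∀ᶠ s in 𝓝 t, χ s = 1 := χ.eventuallyEq_one
  have hχt : χ t = 1 := hone.self_of_nhds
  have hperiod : ∀ {α : Type} {g : (Fin 3 → ℝ) × ℝ → α},
      (∀ (x : Fin 3 → ℝ) (s : ℝ) (n : Fin 3 → ℤ), g (x + fun i => (n i : ℝ), s) = g (x, s)) →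
      ∀ i p, g (p + spaceDir i) = g p := by
    intro α g hg i p
    have hsingle : (fun j => ((Pi.single i 1 : Fin 3 → ℤ) j : ℝ)) = Pi.single i 1 := by
      funext j
      by_cases hj : j = i
      · subst hj; simp
      · simp [hj]
    have h := hg p.1 p.2 (Pi.single i 1)
    rw [hsingle] at h
    rw [show p + spaceDir i = (p.1 + Pi.single i 1, p.2) by ext <;> simp [spaceDir], h]
  have hsnd : ∀ i, (spaceDir i).2 = 0 := fun _ => rfl
  have hderiv : ∀ g : ℝ → ℝ, deriv (fun s => χ s * g s) t = deriv g t := fun g =>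
    Filter.EventuallyEq.deriv_eq (hone.mono fun s hs => by simp [hs])
  have key := hasDerivAt_setIntegral_energyDensity (u := fun k p => χ p.2 * u p k)
    (d := fun k p => χ p.2 * d p k) (P := fun p => χ p.2 * P p) t
    (fun k => contDiff_timeCutoff_mul (contDiffOn_pi.1 hu k) hχ hsupp)
    (fun k => contDiff_timeCutoff_mul (contDiffOn_pi.1 hd k) hχ hsupp)
    (contDiff_timeCutoff_mul hP hχ hsupp)
    (fun k i p => by simp [hperiod huper i p, hsnd])
    (fun k i p => by simp [hperiod hdper i p, hsnd])
    (fun i p => by simp [hperiod hPper i p, hsnd])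
    (by simpa only [hχt, one_mul] using fun x => hdiv x t (Set.Ioo_subset_Icc_self ht))
    (by simpa only [hχt, one_mul, hderiv] using fun x => hmom x t (Set.Ioo_subset_Ioc_self ht))
    (by simpa only [hχt, one_mul, hderiv] using fun x => hdir x t (Set.Ioo_subset_Ioc_self ht))
  simp only [hχt, one_mul] at key
  refine key.congr_of_eventuallyEq (hone.mono fun s hs => ?_)
  simp only [hs, one_mul]
end
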